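/- arXiv:2310.01190 — 4 statements merged into one kernel-verified Lean document; each statement's English description precedes it below -/
import Mathlib

section
/- For all natural numbers n and m, and all indices i with 0 ≤ i ≤ n and j with 0 ≤ j ≤ m, the definite integral over [0,1] of the product of Bernstein basis polynomials satisfies ∫₀¹ b_{i,n}(t) · b_{j,m}(t) dt = (1/(m+n+1)) · (C(n,i)·C(m,j)) / C(m+n, i+j), where C(a,b) denotes the binomial coefficient. -/
/-- The Bernstein basis polynomial `b_{i,n}(t) = C(n,i) tⁱ (1-t)^{n-i}`. -/
noncomputable def bern (n i : ℕ) (t : ℝ) : ℝ :=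
  (n.choose i : ℝ) * t ^ i * (1 - t) ^ (n - i)

theorem integral_pow_mul_one_sub_pow (a b : ℕ) :
    ∫ t in (0:ℝ)..1, t ^ a * (1 - t) ^ b =
      (a.factorial * b.factorial : ℝ) / ((a + b + 1).factorial : ℝ) := by
  induction b generalizing a with
  | zero =>
    have := Nat.factorial_ne_zero a
    simp only [pow_zero, mul_one, integral_pow, Nat.factorial_succ, add_zero, Nat.factorial_zero]
    push_cast
    field_simp
    simp
  | succ b ih =>
    have hderiv (t : ℝ) : HasDerivAt (fun t : ℝ => t ^ (a + 1) * (1 - t) ^ (b + 1))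
        ((a + 1) * (t ^ a * (1 - t) ^ (b + 1)) - (b + 1) * (t ^ (a + 1) * (1 - t) ^ b)) t := by
      have h := ((hasDerivAt_id t).pow (a + 1)).mul
        (((hasDerivAt_id t).const_sub 1).pow (b + 1))
      refine h.congr_deriv ?_
      simp
      ring
    have hint := intervalIntegral.integral_eq_sub_of_hasDerivAt (a := 0) (b := 1)
      (fun t _ => hderiv t) (Continuous.intervalIntegrable (by fun_prop) _ _)
    rw [intervalIntegral.integral_sub (Continuous.intervalIntegrable (by fun_prop) _ _)
      (Continuous.intervalIntegrable (by fun_prop) _ _), intervalIntegral.integral_const_mul,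
      intervalIntegral.integral_const_mul, ih] at hint
    have ha : (a + 1 : ℝ) ≠ 0 := by positivity
    apply mul_left_cancel₀ ha
    rw [show a + (b + 1) + 1 = a + 1 + b + 1 by ring]
    simp only [sub_self, ne_eq, Nat.add_eq_zero_iff, one_ne_zero, and_false, not_false_eq_true,
      zero_pow, mul_zero, zero_mul] at hint
    rw [sub_eq_zero.mp hint, Nat.factorial_succ a, Nat.factorial_succ b]
    push_cast
    ring

/-- The integral over `[0,1]` of a product of Bernstein basis polynomials. -/
theorem bernstein_product_integral (n m i j : ℕ) (hi : i ≤ n) (hj : j ≤ m) :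
    ∫ t in (0:ℝ)..1, bern n i t * bern m j t =
      (1 / ((m : ℝ) + n + 1)) * ((n.choose i : ℝ) * (m.choose j : ℝ)) /
        ((m + n).choose (i + j) : ℝ) := by
  have hprod (t : ℝ) : bern n i t * bern m j t =
      ((n.choose i : ℝ) * m.choose j) * (t ^ (i + j) * (1 - t) ^ (m + n - (i + j))) := by
    rw [show m + n - (i + j) = (n - i) + (m - j) by omega, bern, bern]
    ring
  have hle : i + j ≤ m + n := by omega
  simp only [hprod]
  rw [intervalIntegral.integral_const_mul, integral_pow_mul_one_sub_pow,
    Nat.add_sub_cancel' hle, Nat.cast_choose ℝ hle, Nat.factorial_succ]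
  push_cast
  field_simp
end

section
/- For every natural number n and every vector v = (v_0, …, v_n) ∈ ℝ^{n+1}, the quadratic form of the Bézier norm Hessian is nonnegative and bounded above as follows: 0 ≤ ∫₀¹ ( Σ_{i=0}^n b_{i,n}(t) v_i )² dt ≤ (1/(n+1)) · Σ_{i=0}^n v_i². Equivalently, the matrix H_N(n) with entries [H_N(n)]_{i+1,j+1} = (1/(2n+1)) · (C(n,i)·C(n,j))/C(2n,i+j) satisfies 0 ⪯ H_N(n) ⪯ (1/(n+1))·I. -/
/-- The Bézier norm Hessian `H_N(n)` with entries
`[H_N(n)]_{i+1,j+1} = (1/(2n+1)) C(n,i) C(n,j) / C(2n, i+j)`. -/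
noncomputable def bezierNormHessian (n : ℕ) : Matrix (Fin (n + 1)) (Fin (n + 1)) ℝ :=
  fun i j =>
    (1 / (2 * (n : ℝ) + 1)) * ((n.choose (i : ℕ) : ℝ) * (n.choose (j : ℕ) : ℝ)) /
      ((2 * n).choose ((i : ℕ) + (j : ℕ)) : ℝ)

theorem continuous_bern (n i : ℕ) : Continuous (bern n i) := by
  unfold bern
  fun_prop

theorem bern_nonneg (n i : ℕ) {t : ℝ} (ht : t ∈ Set.Icc (0:ℝ) 1) : 0 ≤ bern n i t := by
  have h0 := ht.1
  have h1 := sub_nonneg.2 ht.2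
  unfold bern
  positivity

theorem sum_bern (n : ℕ) (t : ℝ) : ∑ i ∈ Finset.range (n + 1), bern n i t = 1 := by
  have h := add_pow t (1 - t) n
  rw [add_sub_cancel, one_pow] at h
  rw [h]
  exact Finset.sum_congr rfl fun i _ => by unfold bern; ring

theorem integral_bern {n i : ℕ} (hi : i ≤ n) :
    ∫ t in (0:ℝ)..1, bern n i t = 1 / ((n : ℝ) + 1) := by
  simp only [bern, mul_assoc]
  rw [intervalIntegral.integral_const_mul, integral_pow_mul_one_sub_pow,
    Nat.add_sub_cancel' hi, Nat.cast_choose ℝ hi, Nat.factorial_succ]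
  push_cast
  field_simp

theorem integral_bern_mul_bern {n : ℕ} (i j : Fin (n + 1)) :
    ∫ t in (0:ℝ)..1, bern n i t * bern n j t = bezierNormHessian n i j := by
  have hi : (i : ℕ) ≤ n := by lia
  have hj : (j : ℕ) ≤ n := by lia
  have hij : (i : ℕ) + j ≤ 2 * n := by lia
  have h : ∀ t : ℝ, bern n i t * bern n j t = ((n.choose i : ℝ) * n.choose j) *
      (t ^ ((i : ℕ) + j) * (1 - t) ^ (2 * n - (i + j))) := by
    intro t
    rw [show 2 * n - ((i : ℕ) + j) = (n - i) + (n - j) by lia, pow_add, pow_add]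
    unfold bern
    ring
  simp only [h]
  rw [intervalIntegral.integral_const_mul, integral_pow_mul_one_sub_pow,
    Nat.add_sub_cancel' hij, bezierNormHessian, Nat.cast_choose ℝ hij, Nat.factorial_succ]
  push_cast
  field_simp

theorem integral_sum_bern_sq_nonneg (n : ℕ) (v : ℕ → ℝ) :
    0 ≤ ∫ t in (0:ℝ)..1, (∑ i ∈ Finset.range (n + 1), bern n i t * v i) ^ 2 :=
  intervalIntegral.integral_nonneg zero_le_one fun _ _ => sq_nonneg _

theorem integral_sum_bern_sq_le (n : ℕ) (v : ℕ → ℝ) :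
    ∫ t in (0:ℝ)..1, (∑ i ∈ Finset.range (n + 1), bern n i t * v i) ^ 2 ≤
      (1 / ((n : ℝ) + 1)) * ∑ i ∈ Finset.range (n + 1), v i ^ 2 := by
  have hc := continuous_bern n
  calc ∫ t in (0:ℝ)..1, (∑ i ∈ Finset.range (n + 1), bern n i t * v i) ^ 2
      ≤ ∫ t in (0:ℝ)..1, ∑ i ∈ Finset.range (n + 1), bern n i t * v i ^ 2 := by
        refine intervalIntegral.integral_mono_on zero_le_one
          (Continuous.intervalIntegrable (by fun_prop) _ _)
          (Continuous.intervalIntegrable (by fun_prop) _ _) fun t ht => ?_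
        exact Real.pow_arith_mean_le_arith_mean_pow_of_even _ _ _
          (fun i _ => bern_nonneg n i ht) (sum_bern n t) even_two
    _ = (1 / ((n : ℝ) + 1)) * ∑ i ∈ Finset.range (n + 1), v i ^ 2 := by
        rw [intervalIntegral.integral_finsetSum
          fun i _ => Continuous.intervalIntegrable (by fun_prop) _ _, Finset.mul_sum]
        refine Finset.sum_congr rfl fun i hi => ?_
        rw [intervalIntegral.integral_mul_const,
          integral_bern (Nat.lt_succ_iff.1 (Finset.mem_range.1 hi))]

theorem dotProduct_bezierNormHessian_mulVec (n : ℕ) (v : ℕ → ℝ) :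
    (fun i : Fin (n + 1) => v i) ⬝ᵥ (bezierNormHessian n).mulVec (fun i => v i) =
      ∫ t in (0:ℝ)..1, (∑ i ∈ Finset.range (n + 1), bern n i t * v i) ^ 2 := by
  have hc := continuous_bern n
  simp only [Finset.sum_range, sq, Finset.sum_mul_sum]
  rw [intervalIntegral.integral_finsetSum
    fun i _ => Continuous.intervalIntegrable (by fun_prop) _ _]
  refine Finset.sum_congr rfl fun i _ => ?_
  rw [intervalIntegral.integral_finsetSum
    fun i _ => Continuous.intervalIntegrable (by fun_prop) _ _, Matrix.mulVec, dotProduct,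
    Finset.mul_sum]
  refine Finset.sum_congr rfl fun j _ => ?_
  rw [← integral_bern_mul_bern, ← intervalIntegral.integral_mul_const,
    ← intervalIntegral.integral_const_mul]
  congr 1
  ext t
  ring

theorem isHermitian_bezierNormHessian (n : ℕ) : (bezierNormHessian n).IsHermitian := by
  ext i j
  simp only [Matrix.conjTranspose_apply, bezierNormHessian, star_trivial]
  rw [add_comm (j : ℕ), mul_comm (n.choose j : ℝ)]

theorem exists_nat_extension {n : ℕ} (x : Fin (n + 1) → ℝ) :
    ∃ v : ℕ → ℝ, (fun i : Fin (n + 1) => v i) = x :=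
  ⟨fun k => if h : k < n + 1 then x ⟨k, h⟩ else 0, funext fun i => dif_pos i.isLt⟩

/-- The quadratic form of the Bézier norm Hessian is nonnegative and bounded above by
`(1/(n+1)) ‖v‖²`; equivalently `0 ⪯ H_N(n) ⪯ (1/(n+1)) I`. -/
theorem bezier_norm_hessian_bounds (n : ℕ) :
    (∀ v : ℕ → ℝ,
      0 ≤ ∫ t in (0:ℝ)..1, (∑ i ∈ Finset.range (n + 1), bern n i t * v i) ^ 2 ∧
      (∫ t in (0:ℝ)..1, (∑ i ∈ Finset.range (n + 1), bern n i t * v i) ^ 2) ≤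
        (1 / ((n : ℝ) + 1)) * ∑ i ∈ Finset.range (n + 1), v i ^ 2) ∧
    (bezierNormHessian n).PosSemidef ∧
    ((1 / ((n : ℝ) + 1)) • (1 : Matrix (Fin (n + 1)) (Fin (n + 1)) ℝ) -
        bezierNormHessian n).PosSemidef := by
  refine ⟨fun v => ⟨integral_sum_bern_sq_nonneg n v, integral_sum_bern_sq_le n v⟩, ?_, ?_⟩
  · refine Matrix.PosSemidef.of_dotProduct_mulVec_nonneg (isHermitian_bezierNormHessian n)
      fun x => ?_
    obtain ⟨v, rfl⟩ := exists_nat_extension x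
    rw [star_trivial, dotProduct_bezierNormHessian_mulVec]
    exact integral_sum_bern_sq_nonneg n v
  · refine Matrix.PosSemidef.of_dotProduct_mulVec_nonneg
      ((Matrix.isHermitian_one.smul (IsSelfAdjoint.all _)).sub
        (isHermitian_bezierNormHessian n)) fun x => ?_
    obtain ⟨v, rfl⟩ := exists_nat_extension x
    rw [star_trivial, Matrix.sub_mulVec, dotProduct_sub, dotProduct_bezierNormHessian_mulVec,
      Matrix.smul_mulVec, Matrix.one_mulVec, dotProduct_smul, smul_eq_mul, sub_nonneg]
    have h : (fun i : Fin (n + 1) => v i) ⬝ᵥ (fun i => v i) =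
        ∑ i ∈ Finset.range (n + 1), v i ^ 2 := by
      simp only [Finset.sum_range, dotProduct, sq]
    rw [h]
    exact integral_sum_bern_sq_le n v
end

section
/- Let c_P(t) = Σ_{i=0}^n b_{i,n}(t) p_i be a Bézier curve of degree n with control points p_0, …, p_n ∈ ℝ^d, and let 0 ≤ k ≤ n. Then its k-th derivative is again a Bézier curve, of degree n−k: for all t, d^k/dt^k c_P(t) = (n!/(n−k)!) · Σ_{i=0}^{n−k} b_{i,n−k}(t) q_i, where the new control points are the k-th order forward finite differences q_i = Σ_{j=0}^{k} C(k,j) · (−1)^{k−j} · p_{i+j} for i = 0, …, n−k. -/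
/-- The Bézier curve of degree `n` with control points `p 0, …, p n` in `ℝ^d`. -/
noncomputable def bezier (d n : ℕ) (p : ℕ → EuclideanSpace ℝ (Fin d)) (t : ℝ) :
    EuclideanSpace ℝ (Fin d) :=
  ∑ i ∈ Finset.range (n + 1), bern n i t • p i

theorem bern_eq_eval (n i : ℕ) (t : ℝ) : bern n i t = (bernsteinPolynomial ℝ n i).eval t := by
  simp [bern, bernsteinPolynomial]

theorem hasDerivAt_bern_zero (n : ℕ) (t : ℝ) :
    HasDerivAt (bern (n + 1) 0) (-((n + 1 : ℝ) * bern n 0 t)) t := by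
  have h := (bernsteinPolynomial ℝ (n + 1) 0).hasDerivAt t
  rw [bernsteinPolynomial.derivative_zero] at h
  simpa [funext (bern_eq_eval (n + 1) 0), bern_eq_eval, ← neg_add_rev, add_comm] using h

theorem hasDerivAt_bern_succ (n i : ℕ) (t : ℝ) :
    HasDerivAt (bern (n + 1) (i + 1)) ((n + 1 : ℝ) * (bern n i t - bern n (i + 1) t)) t := by
  have h := (bernsteinPolynomial ℝ (n + 1) (i + 1)).hasDerivAt t
  rw [bernsteinPolynomial.derivative_succ_aux] at h
  simpa [funext (bern_eq_eval (n + 1) (i + 1)), bern_eq_eval] using h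

theorem bern_eq_zero_of_lt {n i : ℕ} (h : n < i) (t : ℝ) : bern n i t = 0 := by
  simp [bern, Nat.choose_eq_zero_of_lt h]

theorem hasDerivAt_bezier (d n : ℕ) (p : ℕ → EuclideanSpace ℝ (Fin d)) (t : ℝ) :
    HasDerivAt (bezier d (n + 1) p) ((n + 1 : ℝ) • bezier d n (fwdDiff 1 p) t) t := by
  have h : HasDerivAt (fun s => ∑ i ∈ Finset.range (n + 1), bern (n + 1) (i + 1) s • p (i + 1) +
      bern (n + 1) 0 s • p 0) _ t :=
    (HasDerivAt.fun_sum fun i _ => (hasDerivAt_bern_succ n i t).smul_const (p (i + 1))).add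
      ((hasDerivAt_bern_zero n t).smul_const (p 0))
  have hfun : bezier d (n + 1) p = fun s =>
      ∑ i ∈ Finset.range (n + 1), bern (n + 1) (i + 1) s • p (i + 1) +
        bern (n + 1) 0 s • p 0 := by
    funext s
    exact Finset.sum_range_succ' _ _
  rw [hfun]
  refine h.congr_deriv ?_
  have hshift : ∑ i ∈ Finset.range (n + 1), bern n (i + 1) t • p (i + 1) + bern n 0 t • p 0 =
      ∑ i ∈ Finset.range (n + 1), bern n i t • p i := by
    rw [← Finset.sum_range_succ' (fun i => bern n i t • p i), Finset.sum_range_succ,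
      bern_eq_zero_of_lt n.lt_succ_self, zero_smul, add_zero]
  simp only [bezier, fwdDiff, smul_sub, Finset.sum_sub_distrib, ← hshift, mul_smul, sub_smul,
    neg_smul, ← Finset.smul_sum]
  module

theorem iteratedDeriv_bezier (d m k : ℕ) (p : ℕ → EuclideanSpace ℝ (Fin d)) :
    iteratedDeriv k (bezier d (m + k) p) =
      (((m + k).factorial : ℝ) / (m.factorial : ℝ)) • bezier d m ((fwdDiff 1)^[k] p) := by
  induction k generalizing p with
  | zero => simp [m.factorial_ne_zero]
  | succ k ih =>
    have h : deriv (bezier d (m + k + 1) p) =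
        ((m + k : ℕ) + 1 : ℝ) • bezier d (m + k) (fwdDiff 1 p) :=
      funext fun t => (hasDerivAt_bezier d (m + k) p t).deriv
    rw [iteratedDeriv_succ', ← add_assoc, h]
    funext t
    rw [iteratedDeriv_const_smul_field, ih, Nat.factorial_succ, Function.iterate_succ_apply]
    simp only [Pi.smul_apply, smul_smul]
    push_cast
    rw [mul_div_assoc]

theorem bezier_congr {d n : ℕ} {p q : ℕ → EuclideanSpace ℝ (Fin d)} (h : ∀ i ≤ n, p i = q i)
    (t : ℝ) : bezier d n p t = bezier d n q t :=
  Finset.sum_congr rfl fun i hi => by rw [h i (Finset.mem_range_succ_iff.mp hi)]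

/-- The `k`-th derivative of a degree-`n` Bézier curve is `n!/(n-k)!` times the
Bézier curve of degree `n-k` whose control points are the `k`-th order forward
finite differences `q i = ∑_{j=0}^k C(k,j) (-1)^{k-j} p (i+j)`. -/
theorem bezier_iteratedDeriv (d n k : ℕ) (hk : k ≤ n)
    (p q : ℕ → EuclideanSpace ℝ (Fin d))
    (hq : ∀ i ≤ n - k, q i = ∑ j ∈ Finset.range (k + 1),
      ((k.choose j : ℝ) * (-1 : ℝ) ^ (k - j)) • p (i + j)) (t : ℝ) :
    iteratedDeriv k (fun s => bezier d n p s) t =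
      ((n.factorial : ℝ) / ((n - k).factorial : ℝ)) • bezier d (n - k) q t := by
  obtain ⟨m, rfl⟩ := Nat.exists_eq_add_of_le' hk
  rw [Nat.add_sub_cancel] at hq ⊢
  rw [iteratedDeriv_bezier, Pi.smul_apply]
  congr 1
  refine bezier_congr (fun i hi => ?_) t
  rw [hq i hi, fwdDiff_iter_eq_sum_shift]
  refine Finset.sum_congr rfl fun j _ => ?_
  rw [← Int.cast_smul_eq_zsmul ℝ, nsmul_one]
  push_cast
  rw [mul_comm]
end

section
/- Let p_0, p_1, p_2, p_3 ∈ ℝ^d and let c(t) = Σ_{i=0}^3 b_{i,3}(t) p_i be the cubic Bézier curve with these control points, and let Δ_i = p_i − p_{i−1} for i = 1, 2, 3 be the first-order differences. Then the total squared acceleration of the curve equals ∫₀¹ ‖c″(t)‖² dt = 6 · Σ_{1 ≤ i < j ≤ 3} ‖Δ_i − Δ_j‖² = 18 · Σ_{i=1}^3 ‖Δ_i − (p_3 − p_0)/3‖²; i.e., for degree n = 3 the Bézier acceleration norm is equivalent (up to the constant 18) to the variance of the first-order differences of the control points. -/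
theorem bern_three_expand {E : Type*} [AddCommGroup E] [Module ℝ E] (p₀ p₁ p₂ p₃ : E) (t : ℝ) :
    bern 3 0 t • p₀ + bern 3 1 t • p₁ + bern 3 2 t • p₂ + bern 3 3 t • p₃ =
      p₀ + t • (3 : ℝ) • (p₁ - p₀) + t ^ 2 • (3 : ℝ) • (p₂ - p₁ - (p₁ - p₀)) +
        t ^ 3 • (p₃ - p₂ - (p₂ - p₁) - (p₂ - p₁ - (p₁ - p₀))) := by
  have h1 : Nat.choose 3 1 = 3 := rfl
  have h2 : Nat.choose 3 2 = 3 := rfl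
  simp only [bern, Nat.choose_zero_right, Nat.choose_self, h1, h2, Nat.reduceSub]
  push_cast
  module

theorem iteratedDeriv_two_cubic {E : Type*} [NormedAddCommGroup E] [NormedSpace ℝ E]
    (u v w x : E) (t : ℝ) :
    iteratedDeriv 2 (fun t : ℝ => u + t • v + t ^ 2 • w + t ^ 3 • x) t =
      (2 : ℝ) • w + (6 * t) • x := by
  have hd : deriv (fun t : ℝ => u + t • v + t ^ 2 • w + t ^ 3 • x) =
      fun t => v + (2 * t) • w + (3 * t ^ 2) • x := by
    funext s
    have h := (((hasDerivAt_id s).smul_const v).const_add u).add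
      ((hasDerivAt_pow 2 s).smul_const w) |>.add ((hasDerivAt_pow 3 s).smul_const x)
    refine (h.congr_deriv ?_).deriv
    norm_num
  rw [iteratedDeriv_succ, iteratedDeriv_one, hd]
  have h := ((((hasDerivAt_id t).const_mul 2).smul_const w).const_add v).add
    (((hasDerivAt_pow 2 t).const_mul 3).smul_const x)
  refine (h.congr_deriv ?_).deriv
  norm_num
  congr 1
  ring

theorem norm_sq_add_smul {E : Type*} [NormedAddCommGroup E] [InnerProductSpace ℝ E]
    (u v : E) (t : ℝ) :
    ‖u + t • v‖ ^ 2 = ‖u‖ ^ 2 + 2 * inner ℝ u v * t + ‖v‖ ^ 2 * t ^ 2 := by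
  rw [norm_add_sq_real, inner_smul_right, norm_smul, mul_pow, Real.norm_eq_abs, sq_abs]
  ring

theorem integral_norm_sq_add_smul {E : Type*} [NormedAddCommGroup E] [InnerProductSpace ℝ E]
    (u v : E) :
    ∫ t in (0 : ℝ)..1, ‖u + t • v‖ ^ 2 = ‖u‖ ^ 2 + inner ℝ u v + ‖v‖ ^ 2 / 3 := by
  simp only [norm_sq_add_smul]
  rw [intervalIntegral.integral_add (Continuous.intervalIntegrable (by fun_prop) _ _)
      (Continuous.intervalIntegrable (by fun_prop) _ _),
    intervalIntegral.integral_add (Continuous.intervalIntegrable (by fun_prop) _ _)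
      (Continuous.intervalIntegrable (by fun_prop) _ _),
    intervalIntegral.integral_const_mul, intervalIntegral.integral_const_mul, integral_id,
    integral_pow, intervalIntegral.integral_const]
  norm_num
  ring

/-- For a cubic Bézier curve with control points `p₀, …, p₃` and first-order
differences `Δᵢ = pᵢ - pᵢ₋₁`, the total squared acceleration equals
`6 ∑_{i<j} ‖Δᵢ - Δⱼ‖² = 18 ∑ᵢ ‖Δᵢ - (p₃-p₀)/3‖²`. -/
theorem cubic_bezier_acceleration_norm (d : ℕ)
    (p₀ p₁ p₂ p₃ : EuclideanSpace ℝ (Fin d))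
    (c : ℝ → EuclideanSpace ℝ (Fin d))
    (hc : ∀ t, c t = bern 3 0 t • p₀ + bern 3 1 t • p₁ + bern 3 2 t • p₂ + bern 3 3 t • p₃)
    (Δ₁ Δ₂ Δ₃ : EuclideanSpace ℝ (Fin d))
    (hΔ₁ : Δ₁ = p₁ - p₀) (hΔ₂ : Δ₂ = p₂ - p₁) (hΔ₃ : Δ₃ = p₃ - p₂) :
    (∫ t in (0:ℝ)..1, ‖iteratedDeriv 2 c t‖ ^ 2) =
        6 * (‖Δ₁ - Δ₂‖ ^ 2 + ‖Δ₁ - Δ₃‖ ^ 2 + ‖Δ₂ - Δ₃‖ ^ 2) ∧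
      6 * (‖Δ₁ - Δ₂‖ ^ 2 + ‖Δ₁ - Δ₃‖ ^ 2 + ‖Δ₂ - Δ₃‖ ^ 2) =
        18 * (‖Δ₁ - (3 : ℝ)⁻¹ • (p₃ - p₀)‖ ^ 2 + ‖Δ₂ - (3 : ℝ)⁻¹ • (p₃ - p₀)‖ ^ 2 +
          ‖Δ₃ - (3 : ℝ)⁻¹ • (p₃ - p₀)‖ ^ 2) := by
  have hmean : p₃ - p₀ = Δ₁ + Δ₂ + Δ₃ := by subst hΔ₁ hΔ₂ hΔ₃; abel
  constructor
  · have hacc (t : ℝ) : iteratedDeriv 2 c t =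
        (6 : ℝ) • (Δ₂ - Δ₁) + t • (6 : ℝ) • (Δ₃ - Δ₂ - (Δ₂ - Δ₁)) := by
      rw [funext fun s => (hc s).trans (bern_three_expand p₀ p₁ p₂ p₃ s),
        iteratedDeriv_two_cubic, ← hΔ₁, ← hΔ₂, ← hΔ₃]
      module
    simp only [hacc]
    rw [integral_norm_sq_add_smul]
    simp only [← real_inner_self_eq_norm_sq, inner_sub_left, inner_sub_right, inner_smul_left,
      inner_smul_right, real_inner_comm Δ₁ Δ₂, real_inner_comm Δ₁ Δ₃, real_inner_comm Δ₂ Δ₃,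
      RCLike.conj_to_real]
    ring
  · rw [hmean]
    simp only [← real_inner_self_eq_norm_sq, inner_sub_left, inner_sub_right, inner_add_left,
      inner_add_right, inner_smul_left, inner_smul_right, real_inner_comm Δ₁ Δ₂,
      real_inner_comm Δ₁ Δ₃, real_inner_comm Δ₂ Δ₃, RCLike.conj_to_real]
    ring
end
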